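/- (Main Theorem, part (b): localization of the minor loop.) Let u be a bimodal input with u_{min,1} < u_{min,2} (so that the minor loop closes at level u_{max,1}). Set ϱ₅ = ϱ₂ + u_{max,1} − u_{min,2}. Then: (i) ϱ₅ ∈ (ϱ₂, ϱ₃]; (ii) there exists a unique t₅ ∈ (t₂, t₃] with u(t₅) = u_{max,1}, and for this t₅ one has ρ_u(t₅) = ϱ₅; (iii) ψ_u(ϱ₅) = u_{max,1} = ψ_u(ϱ₁); and (iv) for y∘ and y∘_u as in the main theorem, the minor loop { (u(t), y∘_u(t)) : t ∈ [t₁, t₅] } equals { (ψ_u(ϱ), y∘(ϱ)) : ϱ ∈ [ϱ₁, ϱ₅] }. -/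

import Mathlib

open MeasureTheory Set

/-- A *bimodal input*: an absolutely continuous function `u : [0,∞) → ℝ`
(represented by `u` together with its a.e.-derivative `du` via the fundamental
theorem of calculus), with essentially bounded derivative, `t4`-periodic,
strictly increasing on `[0,t1]`, strictly decreasing on `[t1,t2]`, strictly
increasing on `[t2,t3]`, strictly decreasing on `[t3,t4]`, taking the
prescribed values at `0, t1, t2, t3, t4`. -/
structure BimodalInput (umin1 umin2 umax1 umax2 t1 t2 t3 t4 : ℝ) where
  u : ℝ → ℝ
  du : ℝ → ℝ
  meas_du : Measurable du
  bdd_du : ∃ C : ℝ, ∀ᵐ τ ∂(volume.restrict (Ici (0:ℝ))), |du τ| ≤ C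
  ftc : ∀ s t : ℝ, 0 ≤ s → s ≤ t → u t - u s = ∫ τ in s..t, du τ
  periodic : ∀ t : ℝ, 0 ≤ t → u (t + t4) = u t
  mono1 : StrictMonoOn u (Icc 0 t1)
  anti1 : StrictAntiOn u (Icc t1 t2)
  mono2 : StrictMonoOn u (Icc t2 t3)
  anti2 : StrictAntiOn u (Icc t3 t4)
  val0 : u 0 = umin1
  val1 : u t1 = umax1
  val2 : u t2 = umin2
  val3 : u t3 = umax2
  val4 : u t4 = umin1

/-- The variation function `ρ_u(t) = ∫₀ᵗ |u̇(τ)| dτ`. -/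
noncomputable def variation (du : ℝ → ℝ) (t : ℝ) : ℝ := ∫ τ in (0:ℝ)..t, |du τ|

/-- The normalized input `ψ_u`, a `ϱ4`-periodic piecewise linear function on
`[0,ϱ4]` determined by the data `u_{min,1}, u_{min,2}, u_{max,1}, u_{max,2}`:
`ψ_u(ϱ)=ϱ+u_{min,1}` on `[0,ϱ1]`, `ψ_u(ϱ)=-ϱ+ϱ1+u_{max,1}` on `[ϱ1,ϱ2]`,
`ψ_u(ϱ)=ϱ-ϱ2+u_{min,2}` on `[ϱ2,ϱ3]`, `ψ_u(ϱ)=-ϱ+ϱ3+u_{max,2}` on `[ϱ3,ϱ4]`,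
where `ϱ1 = u_{max,1}-u_{min,1}`, `ϱ2 = ϱ1+u_{max,1}-u_{min,2}`,
`ϱ3 = ϱ2+u_{max,2}-u_{min,2}`, `ϱ4 = ϱ3+u_{max,2}-u_{min,1}`. -/
noncomputable def psi (umin1 umin2 umax1 umax2 : ℝ) : ℝ → ℝ := fun ϱ =>
  if ϱ ≤ umax1 - umin1 then ϱ + umin1
  else if ϱ ≤ (umax1 - umin1) + umax1 - umin2 then -ϱ + (umax1 - umin1) + umax1
  else if ϱ ≤ ((umax1 - umin1) + umax1 - umin2) + umax2 - umin2 then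
    ϱ - ((umax1 - umin1) + umax1 - umin2) + umin2
  else -ϱ + (((umax1 - umin1) + umax1 - umin2) + umax2 - umin2) + umax2

/-- The derivative `ψ̇_u` of the normalized input: `+1` on `(0,ϱ1) ∪ (ϱ2,ϱ3)`
and `-1` on `(ϱ1,ϱ2) ∪ (ϱ3,ϱ4)` (the values at the finitely many breakpoints
are irrelevant). -/
noncomputable def psiDeriv (umin1 umin2 umax1 umax2 : ℝ) : ℝ → ℝ := fun ϱ =>
  if ϱ ≤ umax1 - umin1 then 1
  else if ϱ ≤ (umax1 - umin1) + umax1 - umin2 then -1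
  else if ϱ ≤ ((umax1 - umin1) + umax1 - umin2) + umax2 - umin2 then 1
  else -1

/-- If the indefinite integral of `f` is monotone on `[a, b]`, then the integral of `|f|` over
`[a, b]` is the increment of that indefinite integral. -/
theorem intervalIntegral_abs_eq_sub_of_monotoneOn {f F : ℝ → ℝ} {a b : ℝ} (hab : a ≤ b)
    (hf : IntervalIntegrable f volume a b)
    (hF : ∀ x ∈ Icc a b, F x - F a = ∫ τ in a..x, f τ) (hmono : MonotoneOn F (Icc a b)) :
    ∫ τ in a..b, |f τ| = F b - F a := by
  rw [hF b (right_mem_Icc.2 hab)]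
  apply intervalIntegral.integral_congr_ae
  have hne : ∀ᵐ x : ℝ, x ≠ b := by simp [ae_iff]
  filter_upwards [hf.ae_hasDerivAt_integral, hne] with x hderiv hxb hx
  rw [uIoc_of_le hab] at hx
  rw [uIcc_of_le hab] at hderiv
  have hnhds : Icc a b ∈ nhds x := Icc_mem_nhds hx.1 (lt_of_le_of_ne hx.2 hxb)
  refine abs_of_nonneg (((hderiv (Ioc_subset_Icc_self hx) a
    (left_mem_Icc.2 hab)).hasDerivWithinAt (s := Icc a b)).nonneg_of_monotoneOn ?_ ?_)
  · rw [accPt_principal_iff_nhdsWithin, sdiff_eq, inter_comm,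
      nhdsWithin_inter_of_mem' (mem_nhdsWithin_of_mem_nhds hnhds)]
    infer_instance
  · intro y hy z hz hyz
    simp only [← hF y hy, ← hF z hz]
    linarith [hmono hy hz hyz]

/-- If the indefinite integral of `f` is antitone on `[a, b]`, then the integral of `|f|` over
`[a, b]` is the decrement of that indefinite integral. -/
theorem intervalIntegral_abs_eq_sub_of_antitoneOn {f F : ℝ → ℝ} {a b : ℝ} (hab : a ≤ b)
    (hf : IntervalIntegrable f volume a b)
    (hF : ∀ x ∈ Icc a b, F x - F a = ∫ τ in a..x, f τ) (hanti : AntitoneOn F (Icc a b)) :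
    ∫ τ in a..b, |f τ| = F a - F b := by
  have h := intervalIntegral_abs_eq_sub_of_monotoneOn (f := fun τ => -f τ) (F := fun τ => -F τ)
    hab hf.neg (fun x hx => by rw [intervalIntegral.integral_neg, ← hF x hx]; ring) hanti.neg
  simp only [abs_neg] at h
  linarith

namespace BimodalInput

variable {umin1 umin2 umax1 umax2 t1 t2 t3 t4 : ℝ}

theorem intervalIntegrable_du (B : BimodalInput umin1 umin2 umax1 umax2 t1 t2 t3 t4)
    {s t : ℝ} (hs : 0 ≤ s) (hst : s ≤ t) : IntervalIntegrable B.du volume s t := by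
  obtain ⟨C, hC⟩ := B.bdd_du
  rw [intervalIntegrable_iff_integrableOn_Ioc_of_le hst]
  have hsub : Ioc s t ⊆ Ici 0 := fun x hx => hs.trans hx.1.le
  exact Measure.integrableOn_of_bounded (M := C) (by simp) B.meas_du.aestronglyMeasurable
    (ae_restrict_of_ae_restrict_of_subset hsub hC)

theorem variation_add_integral (B : BimodalInput umin1 umin2 umax1 umax2 t1 t2 t3 t4)
    {s t : ℝ} (hs : 0 ≤ s) (hst : s ≤ t) :
    variation B.du t = variation B.du s + ∫ τ in s..t, |B.du τ| :=
  (intervalIntegral.integral_add_adjacent_intervals (B.intervalIntegrable_du le_rfl hs).abs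
    (B.intervalIntegrable_du hs hst).abs).symm

theorem variation_of_monotoneOn (B : BimodalInput umin1 umin2 umax1 umax2 t1 t2 t3 t4)
    {s t : ℝ} (hs : 0 ≤ s) (hst : s ≤ t) (hmono : MonotoneOn B.u (Icc s t)) :
    variation B.du t = variation B.du s + (B.u t - B.u s) := by
  rw [B.variation_add_integral hs hst, intervalIntegral_abs_eq_sub_of_monotoneOn hst
    (B.intervalIntegrable_du hs hst) (fun x hx => B.ftc s x hs hx.1) hmono]

theorem variation_of_antitoneOn (B : BimodalInput umin1 umin2 umax1 umax2 t1 t2 t3 t4)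
    {s t : ℝ} (hs : 0 ≤ s) (hst : s ≤ t) (hanti : AntitoneOn B.u (Icc s t)) :
    variation B.du t = variation B.du s + (B.u s - B.u t) := by
  rw [B.variation_add_integral hs hst, intervalIntegral_abs_eq_sub_of_antitoneOn hst
    (B.intervalIntegrable_du hs hst) (fun x hx => B.ftc s x hs hx.1) hanti]

theorem continuousOn_variation (B : BimodalInput umin1 umin2 umax1 umax2 t1 t2 t3 t4)
    {T : ℝ} (hT : 0 ≤ T) : ContinuousOn (variation B.du) (Icc 0 T) := by
  have h := intervalIntegral.continuousOn_primitive_interval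
    ((intervalIntegrable_iff').1 (B.intervalIntegrable_du le_rfl hT).abs)
  rwa [uIcc_of_le hT] at h

theorem continuousOn_u (B : BimodalInput umin1 umin2 umax1 umax2 t1 t2 t3 t4)
    {T : ℝ} (hT : 0 ≤ T) : ContinuousOn B.u (Icc 0 T) := by
  have h := intervalIntegral.continuousOn_primitive_interval
    ((intervalIntegrable_iff').1 (B.intervalIntegrable_du le_rfl hT))
  rw [uIcc_of_le hT] at h
  exact (h.const_add (B.u 0)).congr fun x hx => by
    simp only [← B.ftc 0 x le_rfl hx.1, add_sub_cancel]

theorem variation_on_first_descent (B : BimodalInput umin1 umin2 umax1 umax2 t1 t2 t3 t4)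
    (ht1 : 0 ≤ t1) {t : ℝ} (ht : t ∈ Icc t1 t2) :
    variation B.du t = umax1 - umin1 + (umax1 - B.u t) := by
  rw [B.variation_of_antitoneOn ht1 ht.1 (B.anti1.antitoneOn.mono (Icc_subset_Icc_right ht.2)),
    B.variation_of_monotoneOn le_rfl ht1 B.mono1.monotoneOn, B.val0, B.val1]
  simp [variation]

theorem variation_on_second_ascent (B : BimodalInput umin1 umin2 umax1 umax2 t1 t2 t3 t4)
    (ht1 : 0 ≤ t1) (ht12 : t1 ≤ t2) {t : ℝ} (ht : t ∈ Icc t2 t3) :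
    variation B.du t = umax1 - umin1 + umax1 - umin2 + (B.u t - umin2) := by
  rw [B.variation_of_monotoneOn (ht1.trans ht12) ht.1
      (B.mono2.monotoneOn.mono (Icc_subset_Icc_right ht.2)),
    B.variation_on_first_descent ht1 (right_mem_Icc.2 ht12), B.val2]
  ring

/-- Along the first descent and the second ascent, the input is the normalized input composed
with the variation function. -/
theorem psi_variation (B : BimodalInput umin1 umin2 umax1 umax2 t1 t2 t3 t4)
    (ht1 : 0 ≤ t1) (ht12 : t1 ≤ t2) (hu2M1 : umin2 < umax1) {t : ℝ} (ht : t ∈ Icc t1 t3) :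
    psi umin1 umin2 umax1 umax2 (variation B.du t) = B.u t := by
  rcases le_total t t2 with h | h
  · have hle : B.u t ≤ umax1 :=
      (B.anti1.antitoneOn (left_mem_Icc.2 ht12) ⟨ht.1, h⟩ ht.1).trans_eq B.val1
    have hge : umin2 ≤ B.u t :=
      B.val2.ge.trans (B.anti1.antitoneOn ⟨ht.1, h⟩ (right_mem_Icc.2 ht12) h)
    rw [B.variation_on_first_descent ht1 ⟨ht.1, h⟩]
    unfold psi
    split_ifs <;> linarith
  · have ht23 : t2 ≤ t3 := h.trans ht.2
    have hle : B.u t ≤ umax2 :=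
      (B.mono2.monotoneOn ⟨h, ht.2⟩ (right_mem_Icc.2 ht23) ht.2).trans_eq B.val3
    have hge : umin2 ≤ B.u t :=
      B.val2.ge.trans (B.mono2.monotoneOn (left_mem_Icc.2 ht23) ⟨h, ht.2⟩ h)
    rw [B.variation_on_second_ascent ht1 ht12 ⟨h, ht.2⟩]
    unfold psi
    split_ifs <;> linarith

theorem monotoneOn_variation (B : BimodalInput umin1 umin2 umax1 umax2 t1 t2 t3 t4) :
    MonotoneOn (variation B.du) (Ici 0) := fun s hs t _ hst => by
  rw [B.variation_add_integral hs hst]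
  exact le_add_of_nonneg_right
    (intervalIntegral.integral_nonneg hst fun _ _ => abs_nonneg _)

end BimodalInput

/-- Main Theorem, part (b): localization of the minor loop.
Assuming `u_{min,1} < u_{min,2}`, set `ϱ5 = ϱ2 + u_{max,1} - u_{min,2}`.  Then
(i) `ϱ5 ∈ (ϱ2, ϱ3]`; (ii) there is a unique `t5 ∈ (t2, t3]` with
`u(t5) = u_{max,1}`, and for it `ρ_u(t5) = ϱ5`; (iii) `ψ_u(ϱ5) = u_{max,1} =
ψ_u(ϱ1)`; (iv) the minor loop `{(u(t), y∘_u(t)) : t ∈ [t1, t5]}` equals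
`{(ψ_u(ϱ), y∘(ϱ)) : ϱ ∈ [ϱ1, ϱ5]}`. -/
theorem lugre_minor_loop_localization
    (umin1 umin2 umax1 umax2 t1 t2 t3 t4 : ℝ)
    (hu12 : umin1 < umin2) (hu2M1 : umin2 < umax1) (hM12 : umax1 ≤ umax2)
    (ht1 : 0 < t1) (ht12 : t1 < t2) (ht23 : t2 < t3) (ht34 : t3 < t4)
    (B : BimodalInput umin1 umin2 umax1 umax2 t1 t2 t3 t4)
    (σ0 g0 : ℝ) (hσ0 : 0 < σ0) (hg0 : 0 < g0)
    (a : ℝ) (ha : a = σ0 / g0)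
    (ϱ1 ϱ2 ϱ3 ϱ4 ϱ5 : ℝ)
    (hϱ1 : ϱ1 = umax1 - umin1)
    (hϱ2 : ϱ2 = ϱ1 + umax1 - umin2)
    (hϱ3 : ϱ3 = ϱ2 + umax2 - umin2)
    (hϱ4 : ϱ4 = ϱ3 + umax2 - umin1)
    (hϱ5 : ϱ5 = ϱ2 + umax1 - umin2)
    (y0 : ℝ)
    (hy0 : y0 = g0 * (Real.exp (-(a * ϱ4)) / (1 - Real.exp (-(a * ϱ4)))) *
      (2 * Real.exp (a * ϱ1) - 2 * Real.exp (a * ϱ2) + 2 * Real.exp (a * ϱ3)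
        - Real.exp (a * ϱ4) - 1))
    (Y : ℝ → ℝ)
    (hY : ∀ ϱ : ℝ, Y ϱ = Real.exp (-(a * ϱ)) *
      (y0 + σ0 * ∫ τ in (0:ℝ)..ϱ, Real.exp (a * τ) * psiDeriv umin1 umin2 umax1 umax2 τ))
    (ycircu : ℝ → ℝ)
    (hyu : ∀ t : ℝ, ycircu t = Y (variation B.du t)) :
    (ϱ5 ∈ Ioc ϱ2 ϱ3)
    ∧ (∃! t5 : ℝ, t5 ∈ Ioc t2 t3 ∧ B.u t5 = umax1)
    ∧ (∀ t5 ∈ Ioc t2 t3, B.u t5 = umax1 → variation B.du t5 = ϱ5)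
    ∧ (psi umin1 umin2 umax1 umax2 ϱ5 = umax1
        ∧ psi umin1 umin2 umax1 umax2 ϱ1 = umax1)
    ∧ (∀ t5 ∈ Ioc t2 t3, B.u t5 = umax1 →
        (fun t => (B.u t, ycircu t)) '' Icc t1 t5
          = (fun ϱ => (psi umin1 umin2 umax1 umax2 ϱ, Y ϱ)) '' Icc ϱ1 ϱ5) := by
  have hvar5 : ∀ t5 ∈ Ioc t2 t3, B.u t5 = umax1 → variation B.du t5 = ϱ5 := by
    intro t5 ht5 hval
    rw [B.variation_on_second_ascent ht1.le ht12.le (Ioc_subset_Icc_self ht5), hval]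
    linarith
  have hvar1 : variation B.du t1 = ϱ1 := by
    rw [B.variation_on_first_descent ht1.le (left_mem_Icc.2 ht12.le), B.val1]
    linarith
  have hpsi1 : psi umin1 umin2 umax1 umax2 ϱ1 = umax1 := by
    rw [← hvar1, B.psi_variation ht1.le ht12.le hu2M1 ⟨le_rfl, (ht12.trans ht23).le⟩, B.val1]
  obtain ⟨s, hs, hsval⟩ : ∃ s ∈ Ioc t2 t3, B.u s = umax1 := by
    have hcont : ContinuousOn B.u (Icc t2 t3) :=
      (B.continuousOn_u (by linarith : (0 : ℝ) ≤ t3)).mono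
        (Icc_subset_Icc_left (ht1.trans ht12).le)
    refine intermediate_value_Ioc ht23.le hcont ?_
    rw [B.val2, B.val3]
    exact ⟨hu2M1, hM12⟩
  refine ⟨⟨by linarith, by linarith⟩, ⟨s, ⟨hs, hsval⟩, fun t ht => ?_⟩, hvar5, ⟨?_, hpsi1⟩, ?_⟩
  · exact B.mono2.injOn (Ioc_subset_Icc_self ht.1) (Ioc_subset_Icc_self hs)
      (ht.2.trans hsval.symm)
  · rw [← hvar5 s hs hsval,
      B.psi_variation ht1.le ht12.le hu2M1 ⟨(ht12.trans hs.1).le, hs.2⟩, hsval]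
  · intro t5 ht5 hval
    have ht15 : t1 ≤ t5 := (ht12.trans ht5.1).le
    have himage : variation B.du '' Icc t1 t5 = Icc ϱ1 ϱ5 := by
      rw [← hvar1, ← hvar5 t5 ht5 hval]
      refine Subset.antisymm ?_ (intermediate_value_Icc ht15
        ((B.continuousOn_variation (ht1.le.trans ht15)).mono (Icc_subset_Icc_left ht1.le)))
      exact (B.monotoneOn_variation.mono fun x hx => ht1.le.trans hx.1).image_Icc_subset
    rw [← himage, image_image]
    refine image_congr fun t ht => ?_
    simp only [hyu, B.psi_variation ht1.le ht12.le hu2M1 ⟨ht.1, ht.2.trans ht5.2⟩]
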